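/- Let V be a reflexive Banach space, V_h ⊆ V finite-dimensional subspaces, and A : V → V* a bounded, coercive, pseudomonotone operator. Then for each h the Galerkin problem ⟨A u_h, z_h⟩ = ⟨f, z_h⟩ for all z_h ∈ V_h admits a solution u_h ∈ V_h, and the solutions satisfy a uniform bound ‖u_h‖_V ≤ R with R depending only on the coercivity constants and ‖f‖_{V*}. -/

import Mathlib

open Filter Topology Bornology

/-- An operator `A : V → V*` is pseudomonotone if whenever `u_n ⇀ u₀` weakly and
`limsup ⟨A u_n, u_n − u₀⟩ ≤ 0`, then `⟨A u₀, u₀ − z⟩ ≤ liminf ⟨A u_n, u_n − z⟩` for all `z`. -/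
def Pseudomonotone {V : Type*} [NormedAddCommGroup V] [NormedSpace ℝ V]
    (A : V → (V →L[ℝ] ℝ)) : Prop :=
  ∀ (u : ℕ → V) (u₀ : V),
    (∀ f : V →L[ℝ] ℝ, Tendsto (fun n => f (u n)) atTop (𝓝 (f u₀))) →
    limsup (fun n => A (u n) (u n - u₀)) atTop ≤ 0 →
    ∀ z : V, A u₀ (u₀ - z) ≤ liminf (fun n => A (u n) (u n - z)) atTop


open MeasureTheory

noncomputable def evAt {E : Type*} [TopologicalSpace E] (x : E) : C(E, ℝ) →+* ℝ :=
  (Pi.evalRingHom (fun _ : E => ℝ) x).comp ContinuousMap.coeFnRingHom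

theorem poly_integral {E : Type*} [NormedAddCommGroup E] [InnerProductSpace ℝ E]
    [MeasurableSpace E] [BorelSpace E] (μ : Measure E) [IsFiniteMeasureOnCompacts μ]
    (B : Set E) (hB : IsCompact B) (p : Polynomial C(E, ℝ)) :
    ∃ P : Polynomial ℝ, ∀ t : ℝ,
      P.eval t = ∫ x in B, p.eval₂ (evAt x) t ∂μ := by
  refine ⟨∑ k ∈ Finset.range (p.natDegree + 1),
    Polynomial.monomial k (∫ x in B, p.coeff k x ∂μ), fun t => ?_⟩
  have : ∀ x, p.eval₂ (evAt x) t
      = ∑ k ∈ Finset.range (p.natDegree + 1), p.coeff k x * t ^ k := by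
    intro x
    rw [Polynomial.eval₂_eq_sum_range]
    rfl
  simp_rw [this]
  rw [integral_finsetSum]
  · simp [Polynomial.eval_finsetSum, integral_mul_const]
  · intro k _
    exact (((p.coeff k).continuous.mul continuous_const).continuousOn).integrableOn_compact hB

theorem poly_rep {n : ℕ} (h : EuclideanSpace ℝ (Fin n) → EuclideanSpace ℝ (Fin n))
    (hh : ContDiff ℝ 1 h) (M : ℝ) (m : ℕ) :
    ∃ p : Polynomial C(EuclideanSpace ℝ (Fin n), ℝ), ∀ t x,
      p.eval₂ (evAt x) t
      = (M ^ 2 - ‖x + t • h x‖ ^ 2) ^ m *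
        (ContinuousLinearMap.id ℝ (EuclideanSpace ℝ (Fin n)) + t • fderiv ℝ h x).det := by
  classical
  have hc := hh.continuous
  have hd : Continuous (fderiv ℝ h) := hh.continuous_fderiv one_ne_zero
  let E := EuclideanSpace ℝ (Fin n)
  let b := (EuclideanSpace.basisFun (Fin n) ℝ).toBasis
  let c0 : C(E, ℝ) := ⟨fun x => M ^ 2 - ‖x‖ ^ 2, by fun_prop⟩
  let c1 : C(E, ℝ) := ⟨fun x => - (2 * inner ℝ x (h x)), by fun_prop⟩
  let c2 : C(E, ℝ) := ⟨fun x => - ‖h x‖ ^ 2, by fun_prop⟩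
  let a : Polynomial C(E, ℝ) := Polynomial.C c0 + Polynomial.X * Polynomial.C c1
    + Polynomial.X ^ 2 * Polynomial.C c2
  let d : Fin n → Fin n → C(E, ℝ) := fun i j => ⟨fun x => (fderiv ℝ h x (b j)) i, by
    have : Continuous fun x => fderiv ℝ h x (b j) := by fun_prop
    fun_prop⟩
  let Mx : Matrix (Fin n) (Fin n) (Polynomial C(E, ℝ)) :=
    1 + Matrix.of fun i j => Polynomial.X * Polynomial.C (d i j)
  refine ⟨a ^ m * Mx.det, fun t x => ?_⟩
  let ev : Polynomial C(E, ℝ) →+* ℝ :=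
    Polynomial.eval₂RingHom (evAt x) t
  change ev (a ^ m * Mx.det) = _
  rw [map_mul, map_pow, RingHom.map_det]
  congr 1
  · congr 1
    simp only [ev, a, Polynomial.coe_eval₂RingHom, Polynomial.eval₂_add, Polynomial.eval₂_mul,
      Polynomial.eval₂_C, Polynomial.eval₂_X, Polynomial.eval₂_X_pow]
    rw [norm_add_sq_real, norm_smul, inner_smul_right, mul_pow, Real.norm_eq_abs, sq_abs]
    change (M ^ 2 - ‖x‖ ^ 2) + t * (-(2 * inner ℝ x (h x))) + t ^ 2 * (-‖h x‖ ^ 2) = _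
    ring
  · rw [ContinuousLinearMap.det, ← LinearMap.det_toMatrix b]
    congr 1
    ext i j
    rw [LinearMap.toMatrix_apply]
    simp only [Mx, RingHom.mapMatrix_apply, Matrix.map_apply, Matrix.add_apply, map_add,
      Matrix.of_apply, ev, Polynomial.coe_eval₂RingHom, Polynomial.eval₂_mul, 
      Polynomial.eval₂_C, Polynomial.eval₂_X, Matrix.one_apply]
    change _ + t * (fderiv ℝ h x (b j)) i = _
    have : b.repr (b j + t • fderiv ℝ h x (b j)) i = (if i = j then 1 else 0)
       + t * (fderiv ℝ h x (b j)) i := by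
      rw [map_add, map_smul, Finsupp.add_apply, Finsupp.smul_apply, Module.Basis.repr_self]
      simp [Finsupp.single_apply, eq_comm, b]
    refine Eq.trans ?_ this.symm
    split_ifs <;> simp

theorem image_ball {E : Type*} [NormedAddCommGroup E] [NormedSpace ℝ E] [CompleteSpace E]
    (k : E → E) (L : NNReal) (hL : L < 1) (hk : LipschitzWith L k) (B : Set E)
    (hB : ∀ x, x ∉ B → k x = 0) :
    Function.Injective (fun x => x + k x) ∧ (fun x => x + k x) '' B = B := by
  have hinj : Function.Injective (fun x => x + k x) := by
    intro x y hxy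
    simp only at hxy
    have h1 := hk.dist_le_mul x y
    have h2 : x - y = k y - k x := by
      rw [sub_eq_sub_iff_add_eq_add, hxy, add_comm]
    rw [dist_eq_norm, dist_eq_norm, norm_sub_rev, ← h2] at h1
    have h3 : (L : ℝ) < 1 := by exact_mod_cast hL
    have h4 : ‖x - y‖ = 0 := by nlinarith [norm_nonneg (x - y)]
    exact sub_eq_zero.1 (norm_eq_zero.1 h4)
  have hsurj : ∀ y, ∃ x, x + k x = y := by
    intro y
    have hc : ContractingWith L (fun x => y - k x) := by
      refine ⟨hL, LipschitzWith.of_dist_le_mul fun a b => ?_⟩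
      rw [dist_sub_left]
      exact hk.dist_le_mul a b
    refine ⟨hc.fixedPoint, ?_⟩
    have := hc.fixedPoint_isFixedPt
    have h' : y - k hc.fixedPoint = hc.fixedPoint := this
    exact (sub_eq_iff_eq_add.1 h').symm
  refine ⟨hinj, ?_⟩
  apply Set.Subset.antisymm
  · rintro _ ⟨x, hx, rfl⟩
    by_contra hcon
    have : (fun x => x + k x) (x + k x) = (fun x => x + k x) x := by
      simp only [hB _ hcon, add_zero]
    have := hinj this
    exact hcon (by simpa only [this] using hx)
  · intro y hy
    obtain ⟨x, rfl⟩ := hsurj y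
    refine ⟨x, ?_, rfl⟩
    by_contra hx
    rw [hB x hx, add_zero] at hy
    exact hx hy

theorem weight_identity {n : ℕ} (h : EuclideanSpace ℝ (Fin n) → EuclideanSpace ℝ (Fin n))
    (hh : ContDiff ℝ 1 h) (hs : HasCompactSupport h) (K : ℝ)
    (hK : ∀ x, x ∉ Metric.closedBall 0 K → h x = 0) (M : ℝ) (m : ℕ) :
    ∫ x in Metric.closedBall 0 K, (M ^ 2 - ‖x + h x‖ ^ 2) ^ m *
        (ContinuousLinearMap.id ℝ (EuclideanSpace ℝ (Fin n)) + fderiv ℝ h x).det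
      = ∫ x : EuclideanSpace ℝ (Fin n) in Metric.closedBall 0 K, (M ^ 2 - ‖x‖ ^ 2) ^ m := by
  obtain ⟨L, hL⟩ := ContDiff.lipschitzWith_of_hasCompactSupport hs hh one_ne_zero
  obtain ⟨p, hp⟩ := poly_rep h hh M m
  obtain ⟨P, hP⟩ := poly_integral (volume : Measure (EuclideanSpace ℝ (Fin n)))
    (Metric.closedBall 0 K) (isCompact_closedBall 0 K) p
  simp_rw [hp] at hP
  set c := ∫ x : (EuclideanSpace ℝ (Fin n)) in Metric.closedBall 0 K, (M ^ 2 - ‖x‖ ^ 2) ^ m with hc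
  -- positivity of the determinant near the identity
  have hdet : ∀ᶠ T in 𝓝 (0 : (EuclideanSpace ℝ (Fin n)) →L[ℝ] (EuclideanSpace ℝ (Fin n))), 0 < (ContinuousLinearMap.id ℝ (EuclideanSpace ℝ (Fin n)) + T).det := by
    have hcont : Continuous fun T : (EuclideanSpace ℝ (Fin n)) →L[ℝ] (EuclideanSpace ℝ (Fin n)) => (ContinuousLinearMap.id ℝ (EuclideanSpace ℝ (Fin n)) + T).det :=
      ContinuousLinearMap.continuous_det.comp (continuous_const.add continuous_id)
    have h0 : (0 : ℝ) < (ContinuousLinearMap.id ℝ (EuclideanSpace ℝ (Fin n)) + 0).det := by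
      rw [add_zero, ContinuousLinearMap.det]
      simp
    exact hcont.continuousAt.eventually (lt_mem_nhds h0)
  obtain ⟨δ, hδ, hδ'⟩ := Metric.eventually_nhds_iff.1 hdet
  have hfb : ∀ x, ‖fderiv ℝ h x‖ ≤ L := fun x => norm_fderiv_le_of_lipschitz ℝ hL
  set r := min (1 / (L + 1 : ℝ)) (δ / (L + 1)) with hr
  have hL0 : (0 : ℝ) ≤ L := L.2
  have hr0 : 0 < r := by positivity
  have key : ∀ t ∈ Set.Ioo 0 r, P.eval t = c := by
    rintro t ⟨ht0, htr⟩
    have ht1 : t * (L + 1) < 1 := by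
      have := htr.trans_le (min_le_left _ _)
      rwa [lt_div_iff₀ (by positivity)] at this
    have ht2 : t * (L + 1) < δ := by
      have := htr.trans_le (min_le_right _ _)
      rwa [lt_div_iff₀ (by positivity)] at this
    have hlip : LipschitzWith (t.toNNReal * L) (fun x => t • h x) := by
      refine LipschitzWith.of_dist_le_mul fun a b => ?_
      rw [dist_smul₀, Real.norm_eq_abs, abs_of_pos ht0]
      have := mul_le_mul_of_nonneg_left (hL.dist_le_mul a b) ht0.le
      rw [NNReal.coe_mul, Real.coe_toNNReal t ht0.le, mul_assoc]
      exact this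
    obtain ⟨hinj, him⟩ := image_ball (fun x => t • h x) (t.toNNReal * L)
      (by
        rw [← NNReal.coe_lt_coe]
        rw [NNReal.coe_mul, Real.coe_toNNReal t ht0.le, NNReal.coe_one]
        nlinarith) hlip (Metric.closedBall 0 K) (fun x hx => by simp [hK x hx])
    rw [hP, hc]
    have hcv := integral_image_eq_integral_abs_det_fderiv_smul (volume : Measure (EuclideanSpace ℝ (Fin n)))
      (s := Metric.closedBall 0 K) (f := fun x => x + t • h x)
      (f' := fun x => ContinuousLinearMap.id ℝ (EuclideanSpace ℝ (Fin n)) + t • fderiv ℝ h x)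
      Metric.isClosed_closedBall.measurableSet
      (fun x _ => ((hasFDerivAt_id x).add
        (((hh.differentiable one_ne_zero) x).hasFDerivAt.const_smul t)).hasFDerivWithinAt)
      hinj.injOn (fun y => (M ^ 2 - ‖y‖ ^ 2) ^ m)
    rw [him] at hcv
    rw [hcv]
    congr 1
    ext x
    have : 0 < (ContinuousLinearMap.id ℝ (EuclideanSpace ℝ (Fin n)) + t • fderiv ℝ h x).det := by
      apply hδ'
      rw [dist_zero_right, norm_smul, Real.norm_eq_abs, abs_of_pos ht0]
      have := mul_le_mul_of_nonneg_left (hfb x) ht0.le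
      nlinarith
    rw [abs_of_pos this, smul_eq_mul, mul_comm]
  have hPc : P = Polynomial.C c := by
    apply Polynomial.eq_of_infinite_eval_eq
    refine (Set.Ioo_infinite hr0).mono fun t ht => ?_
    simpa using key t ht
  have := hP 1
  rw [hPc] at this
  simpa using this.symm

theorem smooth_zero {n : ℕ} (h : EuclideanSpace ℝ (Fin n) → EuclideanSpace ℝ (Fin n))
    (hh : ContDiff ℝ 1 h) (hs : HasCompactSupport h) : ∃ x, x + h x = 0 := by
  by_contra! hne
  obtain ⟨K, hK0, hK⟩ : ∃ K : ℝ, 0 < K ∧ ∀ x, x ∉ Metric.closedBall (0 : (EuclideanSpace ℝ (Fin n))) K → h x = 0 := by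
    obtain ⟨K, hK⟩ := hs.isBounded.subset_closedBall (0 : (EuclideanSpace ℝ (Fin n)))
    refine ⟨max K 1, by positivity, fun x hx => ?_⟩
    apply image_eq_zero_of_notMem_tsupport
    exact fun hx' => hx (Metric.closedBall_subset_closedBall (le_max_left _ _) (hK hx'))
  set B := Metric.closedBall (0 : (EuclideanSpace ℝ (Fin n))) K
  have hBc : IsCompact B := isCompact_closedBall 0 K
  have hcF : Continuous fun x => x + h x := continuous_id.add hh.continuous
  have h0B : (0 : (EuclideanSpace ℝ (Fin n))) ∈ B := Metric.mem_closedBall_self hK0.le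
  obtain ⟨x0, hx0, hmin⟩ := hBc.exists_isMinOn ⟨0, h0B⟩ hcF.norm.continuousOn
  obtain ⟨x1, hx1, hmax⟩ := hBc.exists_isMaxOn ⟨0, h0B⟩ hcF.norm.continuousOn
  set ε := min ‖x0 + h x0‖ K with hε
  have hε0 : 0 < ε := lt_min (norm_pos_iff.2 (hne x0)) hK0
  set M := max ‖x1 + h x1‖ K with hM
  have hεK : ε ≤ K := min_le_right _ _
  have hKM : K ≤ M := le_max_right _ _
  have hlow : ∀ x ∈ B, ε ≤ ‖x + h x‖ := fun x hx => (min_le_left _ _).trans (hmin hx)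
  have hup : ∀ x ∈ B, ‖x + h x‖ ≤ M := fun x hx => le_trans (hmax hx) (le_max_left _ _)
  have hdc : Continuous fun x => (ContinuousLinearMap.id ℝ (EuclideanSpace ℝ (Fin n)) + fderiv ℝ h x).det :=
    ContinuousLinearMap.continuous_det.comp
      (continuous_const.add (hh.continuous_fderiv one_ne_zero))
  set C := ∫ x in B, |(ContinuousLinearMap.id ℝ (EuclideanSpace ℝ (Fin n)) + fderiv ℝ h x).det| with hC
  set S := Metric.closedBall (0 : (EuclideanSpace ℝ (Fin n))) (ε / 2)
  have hSB : S ⊆ B := Metric.closedBall_subset_closedBall (by linarith)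
  have hSc : IsCompact S := isCompact_closedBall 0 _
  set v := volume.real S with hv
  have hv0 : 0 < v := by
    rw [hv, measureReal_def]
    exact ENNReal.toReal_pos (Metric.measure_closedBall_pos volume 0 (by positivity)).ne'
      hSc.measure_lt_top.ne
  set a := M ^ 2 - ε ^ 2
  set b := M ^ 2 - (ε / 2) ^ 2
  have ha : 0 ≤ a := by simp only [a]; nlinarith
  have hab : a < b := by simp only [a, b]; nlinarith
  have hb : 0 < b := ha.trans_lt hab
  have main : ∀ m : ℕ, b ^ m * v ≤ a ^ m * C := by
    intro m
    have hid := weight_identity h hh hs K hK M m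
    have hpos : ∀ x ∈ B, 0 ≤ M ^ 2 - ‖x‖ ^ 2 := by
      intro x hx
      have : ‖x‖ ≤ K := by simpa [B] using hx
      nlinarith [norm_nonneg x]
    have hcw : Continuous fun x : (EuclideanSpace ℝ (Fin n)) => (M ^ 2 - ‖x‖ ^ 2) ^ m := by fun_prop
    have h1 : b ^ m * v ≤ ∫ x in S, (M ^ 2 - ‖x‖ ^ 2) ^ m := by
      have : ∫ x in S, b ^ m = b ^ m * v := by
        rw [setIntegral_const, smul_eq_mul, mul_comm]
      rw [← this]
      refine setIntegral_mono_on (continuousOn_const.integrableOn_compact hSc)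
        (hcw.continuousOn.integrableOn_compact hSc) hSc.measurableSet fun x hx => ?_
      have : ‖x‖ ≤ ε / 2 := by simpa [S] using hx
      refine pow_le_pow_left₀ hb.le ?_ m
      simp only [b]
      nlinarith [norm_nonneg x]
    have h2 : ∫ x in S, (M ^ 2 - ‖x‖ ^ 2) ^ m ≤ ∫ x in B, (M ^ 2 - ‖x‖ ^ 2) ^ m := by
      refine setIntegral_mono_set (hcw.continuousOn.integrableOn_compact hBc) ?_
        (LE.le.eventuallyLE hSB)
      refine (ae_restrict_iff' hBc.measurableSet).2 (Eventually.of_forall fun x hx => ?_)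
      exact pow_nonneg (hpos x hx) m
    refine h1.trans (h2.trans (hid.symm.le.trans ?_))
    rw [hC, ← integral_const_mul]
    refine setIntegral_mono_on (Continuous.continuousOn (by fun_prop) |>.integrableOn_compact hBc)
      (Continuous.continuousOn (by fun_prop) |>.integrableOn_compact hBc)
      hBc.measurableSet fun x hx => ?_
    have hl := hlow x hx
    have hu := hup x hx
    have e1 : 0 ≤ M ^ 2 - ‖x + h x‖ ^ 2 := by nlinarith
    have e2 : M ^ 2 - ‖x + h x‖ ^ 2 ≤ a := by simp only [a]; nlinarith
    refine (mul_le_mul_of_nonneg_left (le_abs_self _) (pow_nonneg e1 m)).trans ?_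
    exact mul_le_mul_of_nonneg_right (pow_le_pow_left₀ e1 e2 m) (abs_nonneg _)
  have hlim : Tendsto (fun m : ℕ => (a / b) ^ m * C) atTop (𝓝 (0 * C)) :=
    (tendsto_pow_atTop_nhds_zero_of_lt_one (by positivity) ((div_lt_one hb).2 hab)).mul_const C
  have : v ≤ 0 * C := by
    refine ge_of_tendsto' hlim fun m => ?_
    rw [div_pow, div_mul_eq_mul_div, le_div_iff₀ (by positivity), mul_comm]
    exact main m
  linarith

theorem cont_zero {n : ℕ} (h : EuclideanSpace ℝ (Fin n) → EuclideanSpace ℝ (Fin n))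
    (hh : Continuous h) (hs : HasCompactSupport h) : ∃ x, x + h x = 0 := by
  by_contra! hne
  obtain ⟨K, hK0, hK⟩ : ∃ K : ℝ, 0 < K ∧ ∀ x, x ∉ Metric.closedBall (0 : (EuclideanSpace ℝ (Fin n))) K → h x = 0 := by
    obtain ⟨K, hK⟩ := hs.isBounded.subset_closedBall (0 : (EuclideanSpace ℝ (Fin n)))
    refine ⟨max K 1, by positivity, fun x hx => ?_⟩
    apply image_eq_zero_of_notMem_tsupport
    exact fun hx' => hx (Metric.closedBall_subset_closedBall (le_max_left _ _) (hK hx'))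
  have hcF : Continuous fun x => x + h x := continuous_id.add hh
  obtain ⟨x0, hx0, hmin⟩ := (isCompact_closedBall (0 : (EuclideanSpace ℝ (Fin n))) K).exists_isMinOn
    ⟨0, Metric.mem_closedBall_self hK0.le⟩ hcF.norm.continuousOn
  obtain ⟨ε, hε0, hε⟩ : ∃ ε > 0, ∀ x, ε ≤ ‖x + h x‖ := by
    refine ⟨min ‖x0 + h x0‖ K, lt_min (norm_pos_iff.2 (hne x0)) hK0, fun x => ?_⟩
    by_cases hx : x ∈ Metric.closedBall (0 : (EuclideanSpace ℝ (Fin n))) K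
    · exact (min_le_left _ _).trans (hmin hx)
    · rw [hK x hx, add_zero]
      refine (min_le_right _ _).trans ?_
      simp at hx
      exact hx.le
  have huc := hs.uniformContinuous_of_continuous hh
  obtain ⟨δ, hδ, hδ'⟩ := Metric.uniformContinuous_iff.1 huc (ε / 2) (by positivity)
  let φ : ContDiffBump (0 : (EuclideanSpace ℝ (Fin n))) := ⟨δ / 2, δ, by positivity, by linarith⟩
  let k : (EuclideanSpace ℝ (Fin n)) → (EuclideanSpace ℝ (Fin n)) := convolution (φ.normed volume) h (ContinuousLinearMap.lsmul ℝ ℝ) volume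
  have hks : HasCompactSupport k := HasCompactSupport.convolution _ φ.hasCompactSupport_normed hs
  have hkd : ContDiff ℝ 1 k := HasCompactSupport.contDiff_convolution_left (n := 1) _
    φ.hasCompactSupport_normed φ.contDiff_normed hh.locallyIntegrable
  obtain ⟨x, hx⟩ := smooth_zero k hkd hks
  have hd : dist (k x) (h x) ≤ ε / 2 :=
    φ.dist_normed_convolution_le hh.aestronglyMeasurable fun y hy => (hδ' hy).le
  have h3 := hε x
  have h4 : x + h x = h x - k x := by
    calc x + h x = (x + k x) + (h x - k x) := by abel
      _ = h x - k x := by rw [hx, zero_add]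
  rw [h4, ← dist_eq_norm, dist_comm] at h3
  linarith

theorem acute_zero {n : ℕ} (g : EuclideanSpace ℝ (Fin n) → EuclideanSpace ℝ (Fin n))
    (hg : Continuous g) (R : ℝ) (hR : ∀ x, R ≤ ‖x‖ → 0 < inner ℝ (g x) x) : ∃ x, g x = 0 := by
  let χ : (EuclideanSpace ℝ (Fin n)) → ℝ := fun x => max 0 (min 1 (R + 1 - ‖x‖))
  have hχ : Continuous χ := by fun_prop
  have hχ0 : ∀ x, 0 ≤ χ x := fun x => le_max_left _ _
  have hχ1 : ∀ x, χ x ≤ 1 := fun x => max_le zero_le_one (min_le_left _ _)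
  have hχs : ∀ x, x ∉ Metric.closedBall (0 : (EuclideanSpace ℝ (Fin n))) (R + 1) → χ x = 0 := by
    intro x hx
    simp at hx
    exact max_eq_left ((min_le_right _ _).trans (by linarith))
  have hs : HasCompactSupport fun x => χ x • (g x - x) :=
    HasCompactSupport.intro (isCompact_closedBall (0 : (EuclideanSpace ℝ (Fin n))) (R + 1)) fun x hx => by
      simp [hχs x hx]
  obtain ⟨x, hx⟩ := cont_zero (fun x => χ x • (g x - x)) (by fun_prop) hs
  by_cases hxR : R ≤ ‖x‖
  · exfalso
    have h1 := hR x hxR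
    have h2 : inner ℝ (x + χ x • (g x - x)) x = (0 : ℝ) := by rw [hx, inner_zero_left]
    rw [inner_add_left, inner_smul_left, inner_sub_left, real_inner_self_eq_norm_sq] at h2
    simp only [conj_trivial] at h2
    have hx0 : 0 < ‖x‖ := by
      rw [norm_pos_iff]
      rintro rfl
      simp at h1
    rcases (hχ0 x).eq_or_lt with h | h
    · rw [← h] at h2
      nlinarith
    · nlinarith [mul_pos h h1, mul_nonneg (sub_nonneg.2 (hχ1 x)) (sq_nonneg ‖x‖)]
  · have : χ x = 1 := by
      have : min 1 (R + 1 - ‖x‖) = 1 := min_eq_left (by linarith)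
      simp [χ, this]
    rw [this] at hx
    exact ⟨x, by simpa using hx⟩

theorem demicont_lower {V : Type*} [NormedAddCommGroup V] [NormedSpace ℝ V]
    (A : V → (V →L[ℝ] ℝ))
    (hbdd : ∀ s : Set V, IsBounded s → IsBounded (A '' s))
    (hpm : Pseudomonotone A) (u : ℕ → V) (u₀ : V) (hu : Tendsto u atTop (𝓝 u₀)) (w : V)
    (ε : ℝ) (hε : 0 < ε) : ∀ᶠ n in atTop, A u₀ w - ε < A (u n) w := by
  obtain ⟨C, hC⟩ := (hbdd _ (Metric.isBounded_range_of_tendsto u hu)).exists_norm_le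
  have hC' : ∀ n, ‖A (u n)‖ ≤ C := fun n => hC _ ⟨u n, ⟨n, rfl⟩, rfl⟩
  have hd : Tendsto (fun n => u n - u₀) atTop (𝓝 0) := by
    simpa using hu.sub_const u₀
  have ha : Tendsto (fun n => A (u n) (u n - u₀)) atTop (𝓝 0) := by
    have h1 : Tendsto (fun n => C * ‖u n - u₀‖) atTop (𝓝 0) := by
      simpa using hd.norm.const_mul C
    refine squeeze_zero_norm (fun n => ?_) h1
    exact (A (u n)).le_of_opNorm_le (hC' n) _
  have h := hpm u u₀ (fun f => (f.continuous.tendsto u₀).comp hu) ha.limsup_eq.le (u₀ - w)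
  rw [sub_sub_cancel] at h
  have hs : ∀ n, A (u n) (u n - (u₀ - w)) = A (u n) (u n - u₀) + A (u n) w := by
    intro n
    rw [← map_add]
    congr 1
    abel
  have hbd : IsBoundedUnder (· ≥ ·) atTop (fun n => A (u n) (u n - (u₀ - w))) := by
    refine isBoundedUnder_of_eventually_ge (a := -1 - C * ‖w‖) ?_
    filter_upwards [ha.eventually (lt_mem_nhds (show (-1 : ℝ) < 0 by norm_num))] with n hn
    have := (A (u n)).le_of_opNorm_le (hC' n) w
    rw [Real.norm_eq_abs] at this
    rw [hs]
    linarith [(abs_le.1 this).1]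
  have h2 := eventually_lt_of_lt_liminf (b := A u₀ w - ε / 2) (by linarith) hbd
  filter_upwards [h2, ha.eventually (gt_mem_nhds (half_pos hε))] with n hn hn'
  rw [hs] at hn
  linarith

theorem demicont {V : Type*} [NormedAddCommGroup V] [NormedSpace ℝ V]
    (A : V → (V →L[ℝ] ℝ))
    (hbdd : ∀ s : Set V, IsBounded s → IsBounded (A '' s))
    (hpm : Pseudomonotone A) (w : V) : Continuous fun v => A v w := by
  rw [continuous_iff_seqContinuous]
  intro u u₀ hu
  rw [Metric.tendsto_nhds]
  intro ε hε
  filter_upwards [demicont_lower A hbdd hpm u u₀ hu w ε hε,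
    demicont_lower A hbdd hpm u u₀ hu (-w) ε hε] with n h1 h2
  rw [map_neg, map_neg] at h2
  rw [Real.dist_eq, abs_lt]
  simp only [Function.comp_apply]
  constructor <;> linarith

/-- Galerkin existence: if `V` is a reflexive Banach space and `A : V → V*` is bounded,
coercive and pseudomonotone, then for every `f ∈ V*` there is `R > 0` (depending only on
the coercivity and `‖f‖`) such that every finite-dimensional subspace `V_h ⊆ V` contains
a Galerkin solution `u_h` with `⟨A u_h, z_h⟩ = ⟨f, z_h⟩` for all `z_h ∈ V_h` and `‖u_h‖ ≤ R`. -/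
theorem stmt_15 {V : Type*} [NormedAddCommGroup V] [NormedSpace ℝ V] [CompleteSpace V]
    (hrefl : Function.Surjective (NormedSpace.inclusionInDoubleDual ℝ V))
    (A : V → (V →L[ℝ] ℝ))
    (hbdd : ∀ s : Set V, IsBounded s → IsBounded (A '' s))
    (hcoer : ∀ M : ℝ, ∃ R : ℝ, ∀ v : V, R ≤ ‖v‖ → M * ‖v‖ ≤ A v v)
    (hpm : Pseudomonotone A) (f : V →L[ℝ] ℝ) :
    ∃ R > (0 : ℝ), ∀ Vh : Submodule ℝ V, FiniteDimensional ℝ Vh →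
      ∃ u ∈ Vh, (∀ z ∈ Vh, A u z = f z) ∧ ‖u‖ ≤ R := by
  obtain ⟨R₀, hR₀⟩ := hcoer (‖f‖ + 1)
  have hpos : ∀ v : V, max R₀ 1 ≤ ‖v‖ → 0 < A v v - f v := by
    intro v hv
    have h1 := hR₀ v ((le_max_left _ _).trans hv)
    have h2 : 1 ≤ ‖v‖ := (le_max_right _ _).trans hv
    have h3 := (le_abs_self _).trans (f.le_opNorm v)
    linarith
  refine ⟨max R₀ 1, by positivity, fun Vh hVh => ?_⟩
  let b := Module.finBasis ℝ Vh
  let n := Module.finrank ℝ Vh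
  let e : EuclideanSpace ℝ (Fin n) ≃L[ℝ] Vh :=
    ((EuclideanSpace.basisFun (Fin n) ℝ).toBasis.equiv b (Equiv.refl _)).toContinuousLinearEquiv
  let φ : EuclideanSpace ℝ (Fin n) →L[ℝ] V := Vh.subtypeL.comp e.toContinuousLinearMap
  let s : Fin n → EuclideanSpace ℝ (Fin n) := EuclideanSpace.basisFun (Fin n) ℝ
  let g : EuclideanSpace ℝ (Fin n) → EuclideanSpace ℝ (Fin n) := fun x =>
    WithLp.toLp 2 fun i => A (φ x) (φ (s i)) - f (φ (s i))
  have hg : Continuous g := by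
    refine (PiLp.continuous_toLp 2 _).comp (continuous_pi fun i => ?_)
    exact ((demicont A hbdd hpm (φ (s i))).comp φ.continuous).sub continuous_const
  have hin : ∀ x y, inner ℝ (g x) y = A (φ x) (φ y) - f (φ y) := by
    intro x y
    have hy : y = ∑ i, y i • s i := by
      have := (EuclideanSpace.basisFun (Fin n) ℝ).sum_repr y
      simpa [s] using this.symm
    have h1 : ∀ l : V →L[ℝ] ℝ, l (φ y) = ∑ i, y i * l (φ (s i)) := by
      intro l
      conv_lhs => rw [hy]
      simp only [map_sum, map_smul, smul_eq_mul]
    rw [h1, h1, ← Finset.sum_sub_distrib, PiLp.inner_apply]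
    refine Finset.sum_congr rfl fun i _ => ?_
    simp [g]
    ring
  have hnorm : ∀ x, ‖x‖ ≤ ‖(e.symm : Vh →L[ℝ] EuclideanSpace ℝ (Fin n))‖ * ‖φ x‖ := by
    intro x
    have := (e.symm : Vh →L[ℝ] EuclideanSpace ℝ (Fin n)).le_opNorm (e x)
    simpa [φ] using this
  obtain ⟨x, hx⟩ := acute_zero g hg
    (‖(e.symm : Vh →L[ℝ] EuclideanSpace ℝ (Fin n))‖ * max R₀ 1 + 1) (by
      intro x hx
      rw [hin]
      apply hpos
      by_contra! hlt
      have h1 := hnorm x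
      have h2 := mul_le_mul_of_nonneg_left hlt.le
        (norm_nonneg (e.symm : Vh →L[ℝ] EuclideanSpace ℝ (Fin n)))
      linarith)
  have hsol : ∀ z ∈ Vh, A (φ x) z = f z := by
    intro z hz
    have h1 := hin x (e.symm ⟨z, hz⟩)
    have h2 : φ (e.symm ⟨z, hz⟩) = z := by simp [φ]
    rw [hx, inner_zero_left, h2] at h1
    linarith
  have hmem : φ x ∈ Vh := (e x).2
  refine ⟨φ x, hmem, hsol, ?_⟩
  by_contra! hlt
  have h1 := hpos _ hlt.le
  rw [hsol _ hmem] at h1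
  linarith
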